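/- Consider a hidden Markov model (X,Z) with finite state space S, transition matrix A, initial distribution μ, and emission matrix C over alphabet O = {0,...,m}. Fix f : S → ℝ, an adapted control U = (U_0,...,U_{T-1}) with U_t ∈ ℝ^m measurable w.r.t. σ(Z_1,...,Z_t), and let (Y,V) solve the backward stochastic difference equation Y_t(x) = (A Y_{t+1})(x) + c(x)ᵀ(U_t + V_t(x)) - V_t(x)ᵀ e(Z_{t+1}), Y_T = f, with Y_t(x), V_t(x) measurable w.r.t. σ(Z_1,...,Z_t). Define S_T := μ(Y_0) - ∑_{t=0}^{T-1} U_tᵀ e(Z_{t+1}). Then E[|f(X_T) - S_T|²] = var(Y_0(X_0)) + E[∑_{t=0}^{T-1} ((Γ Y_{t+1})(X_t) + (U_t+V_t(X_t))ᵀ R(X_t)(U_t+V_t(X_t)))]. -/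

import Mathlib

open Finset Matrix MeasureTheory

def stdBasis (m : ℕ) (i : Fin m) : Fin m → ℝ := fun j => if j = i then 1 else 0

/-- The balanced encoding `e : {0,1,…,m} → ℝ^m`. -/
def balancedEncoding (m : ℕ) (z : Fin (m + 1)) : Fin m → ℝ :=
  if h : (z : ℕ) = 0 then -∑ i : Fin m, stdBasis m i
  else stdBasis m ⟨(z : ℕ) - 1, by omega⟩

section

variable (d m : ℕ) (A : Fin d → Fin d → ℝ) (Cmat : Fin d → Fin (m + 1) → ℝ)

/-- `c(x)_i = C(x,i) - C(x,0)`. -/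
def cvec (x : Fin d) : Fin m → ℝ := fun i => Cmat x i.succ - Cmat x 0

/-- `R(x) = diag(c(x)) + C(x,0)(I + 𝟙𝟙ᵀ) - c(x)c(x)ᵀ`. -/
noncomputable def Rmat (x : Fin d) : Matrix (Fin m) (Fin m) ℝ :=
  Matrix.diagonal (cvec d m Cmat x) +
    Cmat x 0 • ((1 : Matrix (Fin m) (Fin m) ℝ) +
      vecMulVec (fun _ => (1 : ℝ)) (fun _ => (1 : ℝ))) -
    vecMulVec (cvec d m Cmat x) (cvec d m Cmat x)

/-- `(Γg)(x) = ∑_y A(x,y) g(y)² - (Ag)(x)²`. -/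
def carre (g : Fin d → ℝ) (x : Fin d) : ℝ :=
  (∑ y, A x y * g y ^ 2) - (∑ y, A x y * g y) ^ 2

/-- The σ-algebra generated by the observations `Z_1,…,Z_t`. -/
def obsFiltration {Ω : Type*} (Z : ℕ → Ω → Fin (m + 1)) (T t : ℕ) :
    MeasurableSpace Ω :=
  ⨆ s : Fin T, ⨆ _ : (s : ℕ) < t, MeasurableSpace.comap (Z ((s : ℕ) + 1)) ⊤

section Helpers

variable {d m : ℕ} {A : Fin d → Fin d → ℝ} {Cmat : Fin d → Fin (m + 1) → ℝ}
  {Ω : Type*}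

lemma dotProduct_balancedEncoding_zero (a : Fin m → ℝ) :
    a ⬝ᵥ balancedEncoding m 0 = -∑ i, a i := by
  have : balancedEncoding m 0 = fun _ => -1 := by
    ext j
    simp [balancedEncoding, _root_.stdBasis]
  simp [this, dotProduct]

lemma dotProduct_balancedEncoding_succ (a : Fin m → ℝ) (i : Fin m) :
    a ⬝ᵥ balancedEncoding m i.succ = a i := by
  simp [balancedEncoding, _root_.stdBasis, dotProduct]

lemma sum_emission_mul_dotProduct (x : Fin d) (a : Fin m → ℝ) :
    ∑ z, Cmat x z * (a ⬝ᵥ balancedEncoding m z) = a ⬝ᵥ cvec d m Cmat x := by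
  rw [Fin.sum_univ_succ]
  simp only [dotProduct_balancedEncoding_zero, dotProduct_balancedEncoding_succ]
  simp only [dotProduct, cvec, mul_neg, mul_sum, mul_sub, sum_sub_distrib]
  simp only [mul_comm (a _)]
  ring

lemma dotProduct_Rmat_mulVec (x : Fin d) (a : Fin m → ℝ) :
    a ⬝ᵥ (Rmat d m Cmat x).mulVec a =
      ∑ z, Cmat x z * (a ⬝ᵥ balancedEncoding m z) ^ 2 - (a ⬝ᵥ cvec d m Cmat x) ^ 2 := by
  rw [Fin.sum_univ_succ]
  simp only [dotProduct_balancedEncoding_zero, dotProduct_balancedEncoding_succ]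
  have h1 : a ⬝ᵥ (Matrix.diagonal (cvec d m Cmat x)).mulVec a =
      ∑ i, Cmat x i.succ * a i ^ 2 - Cmat x 0 * ∑ i, a i ^ 2 := by
    simp only [dotProduct, Matrix.mulVec_diagonal, cvec, mul_sum, ← sum_sub_distrib]
    exact sum_congr rfl fun i _ => by ring
  have h2 : ((fun _ => (1 : ℝ)) : Fin m → ℝ) ⬝ᵥ a = ∑ i, a i := by simp [dotProduct]
  have h3 : a ⬝ᵥ ((fun _ => (1 : ℝ)) : Fin m → ℝ) = ∑ i, a i := by simp [dotProduct]
  have h4 : a ⬝ᵥ a = ∑ i, a i ^ 2 := by simp [dotProduct, sq]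
  simp only [Rmat, Matrix.sub_mulVec, Matrix.add_mulVec, Matrix.smul_mulVec,
    Matrix.vecMulVec_mulVec, Matrix.one_mulVec, dotProduct_sub, dotProduct_add, dotProduct_smul,
    h1, h2, h3, h4, smul_eq_mul, op_smul_eq_smul]
  rw [dotProduct_comm (cvec d m Cmat x) a]
  ring

/-- Conditional second moment of a one-step increment of the error process. -/
lemma sum_transition_emission_sq (x : Fin d) (hA : ∑ y, A x y = 1) (hC : ∑ z, Cmat x z = 1)
    (w : ℝ) (a : Fin m → ℝ) (g : Fin (m + 1) → Fin d → ℝ) :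
    ∑ y, ∑ z, A x y * Cmat x z *
        (w + (g z y - ∑ y', A x y' * g z y') +
          (a ⬝ᵥ balancedEncoding m z - a ⬝ᵥ cvec d m Cmat x)) ^ 2 =
      ∑ y, ∑ z, A x y * Cmat x z *
        (w ^ 2 + (carre d A (g z) x + a ⬝ᵥ (Rmat d m Cmat x).mulVec a)) := by
  have inner (k : ℝ) (h : Fin d → ℝ) :
      ∑ y, A x y * (k + (h y - ∑ y', A x y' * h y')) ^ 2 = k ^ 2 + carre d A h x := by
    set b := ∑ y', A x y' * h y' with hb
    have : ∀ y, A x y * (k + (h y - b)) ^ 2 =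
        (k - b) ^ 2 * A x y + 2 * (k - b) * (A x y * h y) + A x y * h y ^ 2 := fun y => by ring
    simp only [this, sum_add_distrib, ← mul_sum, hA, ← hb, carre]
    ring
  have hleft : ∀ y z, A x y * Cmat x z *
        (w + (g z y - ∑ y', A x y' * g z y') +
          (a ⬝ᵥ balancedEncoding m z - a ⬝ᵥ cvec d m Cmat x)) ^ 2 =
      Cmat x z * (A x y * ((w + (a ⬝ᵥ balancedEncoding m z - a ⬝ᵥ cvec d m Cmat x)) +
        (g z y - ∑ y', A x y' * g z y')) ^ 2) := fun y z => by ring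
  have hright : ∀ y z, A x y * Cmat x z *
        (w ^ 2 + (carre d A (g z) x + a ⬝ᵥ (Rmat d m Cmat x).mulVec a)) =
      A x y * (Cmat x z *
        (w ^ 2 + (carre d A (g z) x + a ⬝ᵥ (Rmat d m Cmat x).mulVec a))) := fun y z => by ring
  simp only [hleft, hright]
  rw [sum_comm]
  simp only [← mul_sum, inner]
  rw [← sum_mul, hA, one_mul, dotProduct_Rmat_mulVec]
  set r := ∑ z, Cmat x z * (a ⬝ᵥ balancedEncoding m z) ^ 2 with hr
  have hb := sum_emission_mul_dotProduct (Cmat := Cmat) x a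
  set b := a ⬝ᵥ cvec d m Cmat x
  have e1 : ∀ z, Cmat x z * ((w + (a ⬝ᵥ balancedEncoding m z - b)) ^ 2 + carre d A (g z) x) =
      (w - b) ^ 2 * Cmat x z + 2 * (w - b) * (Cmat x z * (a ⬝ᵥ balancedEncoding m z)) +
        Cmat x z * (a ⬝ᵥ balancedEncoding m z) ^ 2 + Cmat x z * carre d A (g z) x :=
    fun z => by ring
  have e2 : ∀ z, Cmat x z * (w ^ 2 + (carre d A (g z) x + (r - b ^ 2))) =
      (w ^ 2 + (r - b ^ 2)) * Cmat x z + Cmat x z * carre d A (g z) x := fun z => by ring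
  simp only [e1, e2, sum_add_distrib, ← mul_sum, hC, hb, ← hr]
  ring

lemma integrable_comp_of_finite [MeasurableSpace Ω] {P : Measure Ω} [IsFiniteMeasure P] {β : Type*} [Finite β] [MeasurableSpace β]
    [MeasurableSingletonClass β] {Φ : Ω → β} (hΦ : Measurable Φ) (k : β → ℝ) :
    Integrable (fun ω => k (Φ ω)) P :=
  (Integrable.of_finite (μ := P.map Φ) (f := k)).comp_measurable hΦ

lemma integral_comp_of_fintype [MeasurableSpace Ω] {P : Measure Ω} [IsFiniteMeasure P] {β : Type*} [Fintype β] [MeasurableSpace β]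
    [MeasurableSingletonClass β] {Φ : Ω → β} (hΦ : Measurable Φ) (k : β → ℝ) :
    ∫ ω, k (Φ ω) ∂P = ∑ b, P.real {ω | Φ ω = b} * k b := by
  have : Integrable k (P.map Φ) := .of_finite
  rw [← integral_map hΦ.aemeasurable this.aestronglyMeasurable, integral_fintype this]
  refine sum_congr rfl fun b _ => ?_
  rw [map_measureReal_apply hΦ (measurableSet_singleton b)]
  rfl

/-- A function measurable for the observations up to time `t` depends only on them. -/
lemma eq_of_measurable_obsFiltration {E : Type*} [MeasurableSpace E] [MeasurableSingletonClass E]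
    {Z : ℕ → Ω → Fin (m + 1)} {T t : ℕ} {g : Ω → E} (hg : Measurable[obsFiltration m Z T t] g)
    {ω ω' : Ω} (h : ∀ s < t, Z (s + 1) ω = Z (s + 1) ω') : g ω = g ω' := by
  have hle : obsFiltration m Z T t ≤
      MeasurableSpace.comap (fun ω (s : Fin t) => Z (s + 1) ω) ⊤ := by
    refine iSup_le fun s => iSup_le fun hs => ?_
    have : Z ((s : ℕ) + 1) = (fun v : Fin t → Fin (m + 1) => v ⟨s, hs⟩) ∘
        (fun ω (s : Fin t) => Z (s + 1) ω) := rfl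
    rw [this, ← MeasurableSpace.comap_comp]
    exact MeasurableSpace.comap_mono le_top
  have hg' : Measurable[MeasurableSpace.comap (fun ω (s : Fin t) => Z (s + 1) ω) ⊤] g :=
    hg.mono hle le_rfl
  exact Measurable.factorsThrough (mY := ⊤) hg' (funext fun s => h s s.2)

/-- States `X_0,…,X_t` and observations `Z_1,…,Z_t` up to time `t`. -/
def history (X : ℕ → Ω → Fin d) (Z : ℕ → Ω → Fin (m + 1)) (t : ℕ) (ω : Ω) :
    (Fin (t + 1) → Fin d) × (Fin t → Fin (m + 1)) :=
  (fun s => X s ω, fun s => Z (s + 1) ω)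

lemma history_eq_iff {X : ℕ → Ω → Fin d} {Z : ℕ → Ω → Fin (m + 1)} {t : ℕ} {ω ω' : Ω} :
    history X Z t ω = history X Z t ω' ↔
      (∀ s ≤ t, X s ω = X s ω') ∧ ∀ s < t, Z (s + 1) ω = Z (s + 1) ω' := by
  simp [history, funext_iff, Fin.forall_iff]

lemma measurable_history [MeasurableSpace Ω] {X : ℕ → Ω → Fin d} {Z : ℕ → Ω → Fin (m + 1)}
    (hXm : ∀ t, Measurable (X t)) (hZm : ∀ t, Measurable (Z t)) (t : ℕ) :
    Measurable (history X Z t) :=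
  (measurable_pi_lambda _ fun _ => hXm _).prodMk (measurable_pi_lambda _ fun _ => hZm _)

/-- The event that states and observations up to time `t` follow given sequences. -/
def pathEvent (X : ℕ → Ω → Fin d) (Z : ℕ → Ω → Fin (m + 1)) (t : ℕ)
    (xs : ℕ → Fin d) (zs : ℕ → Fin (m + 1)) : Set Ω :=
  {ω | (∀ s ≤ t, X s ω = xs s) ∧ ∀ s < t, Z (s + 1) ω = zs s}

lemma pathEvent_succ_update (X : ℕ → Ω → Fin d) (Z : ℕ → Ω → Fin (m + 1)) (t : ℕ)
    (xs : ℕ → Fin d) (zs : ℕ → Fin (m + 1)) (y : Fin d) (z : Fin (m + 1)) :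
    pathEvent X Z (t + 1) (Function.update xs (t + 1) y) (Function.update zs t z) =
      {ω | ω ∈ pathEvent X Z t xs zs ∧ X (t + 1) ω = y ∧ Z (t + 1) ω = z} := by
  ext ω
  simp only [pathEvent, Set.mem_ofPred_eq]
  constructor
  · rintro ⟨h1, h2⟩
    refine ⟨⟨fun s hs => ?_, fun s hs => ?_⟩, ?_, ?_⟩
    · simpa [Function.update_of_ne (show s ≠ t + 1 by omega)] using h1 s (by omega)
    · simpa [Function.update_of_ne (show s ≠ t by omega)] using h2 s (by omega)
    · simpa using h1 (t + 1) le_rfl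
    · simpa using h2 t (by omega)
  · rintro ⟨⟨h1, h2⟩, h3, h4⟩
    refine ⟨fun s hs => ?_, fun s hs => ?_⟩
    · rcases Nat.le_succ_iff.1 hs with h | rfl
      · rw [Function.update_of_ne (by omega), h1 s h]
      · simpa using h3
    · rcases Nat.lt_succ_iff_lt_or_eq.1 hs with h | rfl
      · rw [Function.update_of_ne (by omega), h2 s h]
      · simpa using h4

lemma measurableSet_pathEvent [MeasurableSpace Ω] {X : ℕ → Ω → Fin d} {Z : ℕ → Ω → Fin (m + 1)}
    (hXm : ∀ t, Measurable (X t)) (hZm : ∀ t, Measurable (Z t)) (t : ℕ)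
    (xs : ℕ → Fin d) (zs : ℕ → Fin (m + 1)) : MeasurableSet (pathEvent X Z t xs zs) := by
  have : pathEvent X Z t xs zs =
      history X Z t ⁻¹' {((fun s => xs s, fun s => zs s) :
        (Fin (t + 1) → Fin d) × (Fin t → Fin (m + 1)))} := by
    ext ω
    simp [pathEvent, history, funext_iff, Fin.forall_iff]
  rw [this]
  exact measurable_history hXm hZm t (measurableSet_singleton _)

/-- Probability of a path of states and observations under the hidden Markov model. -/
def pathWeight (A : Fin d → Fin d → ℝ) (Cmat : Fin d → Fin (m + 1) → ℝ) (μ : Fin d → ℝ)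
    (t : ℕ) (xs : ℕ → Fin d) (zs : ℕ → Fin (m + 1)) : ℝ :=
  μ (xs 0) * ∏ s ∈ range t, (A (xs s) (xs (s + 1)) * Cmat (xs s) (zs s))

lemma pathWeight_succ_update (μ : Fin d → ℝ) (t : ℕ) (xs : ℕ → Fin d) (zs : ℕ → Fin (m + 1))
    (y : Fin d) (z : Fin (m + 1)) :
    pathWeight A Cmat μ (t + 1) (Function.update xs (t + 1) y) (Function.update zs t z) =
      pathWeight A Cmat μ t xs zs * (A (xs t) y * Cmat (xs t) z) := by
  unfold pathWeight
  rw [prod_range_succ, ← mul_assoc]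
  congr 1
  · congr 1
    refine prod_congr rfl fun s hs => ?_
    have hs' := mem_range.1 hs
    rw [Function.update_of_ne (by omega), Function.update_of_ne (by omega),
      Function.update_of_ne (by omega)]
  · simp

lemma sum_transition_emission (hA : ∀ x, ∑ y, A x y = 1) (hC : ∀ x, ∑ z, Cmat x z = 1)
    (x : Fin d) : ∑ b : Fin d × Fin (m + 1), A x b.1 * Cmat x b.2 = 1 := by
  rw [Fintype.sum_prod_type]
  simp only [← mul_sum, hC, hA, mul_one]

/-- Marginal law of the path up to time `t ≤ T`. -/
lemma measureReal_pathEvent [MeasurableSpace Ω] {P : Measure Ω} [IsFiniteMeasure P] {T : ℕ} {μ : Fin d → ℝ}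
    {X : ℕ → Ω → Fin d} {Z : ℕ → Ω → Fin (m + 1)}
    (hXm : ∀ t, Measurable (X t)) (hZm : ∀ t, Measurable (Z t))
    (hA : ∀ x, ∑ y, A x y = 1) (hC : ∀ x, ∑ z, Cmat x z = 1)
    (hT : ∀ xs zs, P.real (pathEvent X Z T xs zs) = pathWeight A Cmat μ T xs zs)
    {t : ℕ} (ht : t ≤ T) :
    ∀ xs zs, P.real (pathEvent X Z t xs zs) = pathWeight A Cmat μ t xs zs := by
  induction ht using Nat.decreasingInduction with
  | self => exact hT
  | of_succ t ht ih =>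
    intro xs zs
    have hE := measurableSet_pathEvent hXm hZm t xs zs
    have hΦ : Measurable fun ω => (X (t + 1) ω, Z (t + 1) ω) := (hXm _).prodMk (hZm _)
    have h := sum_measureReal_preimage_singleton (μ := P.restrict (pathEvent X Z t xs zs)) univ
      (f := fun ω => (X (t + 1) ω, Z (t + 1) ω))
      (fun b _ => hΦ (measurableSet_singleton b))
    rw [coe_univ, Set.preimage_univ, measureReal_restrict_apply_univ] at h
    rw [← h]
    have hb : ∀ b : Fin d × Fin (m + 1), (P.restrict (pathEvent X Z t xs zs)).real
        ((fun ω => (X (t + 1) ω, Z (t + 1) ω)) ⁻¹' {b}) =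
        pathWeight A Cmat μ t xs zs * (A (xs t) b.1 * Cmat (xs t) b.2) := by
      intro b
      rw [measureReal_restrict_apply (hΦ (measurableSet_singleton b)),
        ← pathWeight_succ_update, ← ih, pathEvent_succ_update]
      congr 1
      ext ω
      simp only [Set.mem_inter_iff, Set.mem_preimage, Set.mem_singleton_iff, Prod.ext_iff,
        Set.mem_ofPred_eq]
      exact and_comm
    simp only [hb, ← mul_sum, sum_transition_emission hA hC, mul_one]

/-- Given the history, the next state and observation are independent with laws `A`, `C`. -/
lemma integral_history_step [MeasurableSpace Ω] {P : Measure Ω} [IsFiniteMeasure P] {t : ℕ} {μ : Fin d → ℝ}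
    {X : ℕ → Ω → Fin d} {Z : ℕ → Ω → Fin (m + 1)}
    (hXm : ∀ t, Measurable (X t)) (hZm : ∀ t, Measurable (Z t))
    (ht : ∀ xs zs, P.real (pathEvent X Z t xs zs) = pathWeight A Cmat μ t xs zs)
    (ht' : ∀ xs zs, P.real (pathEvent X Z (t + 1) xs zs) = pathWeight A Cmat μ (t + 1) xs zs)
    (K : (Fin (t + 1) → Fin d) × (Fin t → Fin (m + 1)) → Fin d → Fin (m + 1) → ℝ) :
    ∫ ω, K (history X Z t ω) (X (t + 1) ω) (Z (t + 1) ω) ∂P =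
      ∫ ω, ∑ y, ∑ z, A (X t ω) y * Cmat (X t ω) z * K (history X Z t ω) y z ∂P := by
  have hH := measurable_history hXm hZm t
  have h1 := integral_comp_of_fintype (P := P) (hH.prodMk ((hXm (t + 1)).prodMk (hZm (t + 1))))
    (fun b => K b.1 b.2.1 b.2.2)
  have h2 := integral_comp_of_fintype (P := P) hH (fun h => ∑ y, ∑ z,
    A (h.1 (Fin.last t)) y * Cmat (h.1 (Fin.last t)) z * K h y z)
  simp only [Fintype.sum_prod_type (α₁ := (Fin (t + 1) → Fin d) × (Fin t → Fin (m + 1)))] at h1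
  refine h1.trans (Eq.trans ?_ h2.symm)
  refine sum_congr rfl fun h _ => ?_
  rw [Fintype.sum_prod_type, mul_sum]
  refine sum_congr rfl fun y _ => ?_
  rw [mul_sum]
  refine sum_congr rfl fun z _ => ?_
  rw [← mul_assoc]
  congr 1
  by_cases hh : ∃ ω₀, history X Z t ω₀ = h
  · obtain ⟨ω₀, rfl⟩ := hh
    have e1 : {ω | history X Z t ω = history X Z t ω₀} =
        pathEvent X Z t (fun s => X s ω₀) (fun s => Z (s + 1) ω₀) :=
      Set.ext fun ω => history_eq_iff
    have e2 : {ω | (history X Z t ω, X (t + 1) ω, Z (t + 1) ω) = (history X Z t ω₀, y, z)} =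
        pathEvent X Z (t + 1) (Function.update (fun s => X s ω₀) (t + 1) y)
          (Function.update (fun s => Z (s + 1) ω₀) t z) := by
      rw [pathEvent_succ_update, ← e1]
      ext ω
      simp [Prod.ext_iff]
    rw [e1, e2, ht, ht', pathWeight_succ_update]
    simp [history]
  · have e1 : {ω | history X Z t ω = h} = ∅ := by
      ext ω
      simpa using fun hω => hh ⟨ω, hω⟩
    have e2 : {ω | (history X Z t ω, X (t + 1) ω, Z (t + 1) ω) = (h, y, z)} = ∅ := by
      ext ω
      simpa using fun hω => absurd ⟨ω, hω⟩ hh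
    rw [e1, e2]
    simp

end Helpers

/-- duality principle for the HMM.  For an adapted control `U`
and an adapted solution `(Y,V)` of the BSΔE with terminal condition `f`,
`E[|f(X_T) - S_T|²] = var(Y_0(X_0)) + E[∑_t (ΓY_{t+1})(X_t) + (U_t+V_t(X_t))ᵀ R(X_t)(U_t+V_t(X_t))]`. -/
theorem duality_hmm {Ω : Type*} [MeasurableSpace Ω]
    (P : Measure Ω) [IsProbabilityMeasure P] (T : ℕ)
    (μ : Fin d → ℝ) (hμ : (∀ x, 0 ≤ μ x) ∧ ∑ x, μ x = 1)
    (hA : ∀ x, (∀ y, 0 ≤ A x y) ∧ ∑ y, A x y = 1)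
    (hC : ∀ x, (∀ z, 0 ≤ Cmat x z) ∧ ∑ z, Cmat x z = 1)
    (X : ℕ → Ω → Fin d) (Z : ℕ → Ω → Fin (m + 1))
    (hXm : ∀ t, Measurable (X t)) (hZm : ∀ t, Measurable (Z t))
    -- joint law of (X_{0:T}, Z_{1:T}): hidden Markov model (μ, A, C)
    (hlaw : ∀ (xs : Fin (T + 1) → Fin d) (zs : Fin T → Fin (m + 1)),
      P {ω | (∀ t : Fin (T + 1), X (t : ℕ) ω = xs t) ∧
             (∀ t : Fin T, Z ((t : ℕ) + 1) ω = zs t)} =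
        ENNReal.ofReal (μ (xs 0) *
          ∏ t : Fin T, (A (xs t.castSucc) (xs t.succ) * Cmat (xs t.castSucc) (zs t))))
    (f : Fin d → ℝ)
    (U : ℕ → Ω → Fin m → ℝ) (Y : ℕ → Fin d → Ω → ℝ) (V : ℕ → Fin d → Ω → Fin m → ℝ)
    -- adaptedness
    (hUad : ∀ t < T, Measurable[obsFiltration m Z T t] (U t))
    (hYad : ∀ t ≤ T, ∀ x, Measurable[obsFiltration m Z T t] (Y t x))
    (hVad : ∀ t < T, ∀ x, Measurable[obsFiltration m Z T t] (V t x))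
    -- BSΔE with terminal condition f
    (hYT : ∀ x, Y T x = fun _ => f x)
    (hBSDE : ∀ t < T, ∀ x, ∀ᵐ ω ∂P,
      Y t x ω = (∑ y, A x y * Y (t + 1) y ω) +
        cvec d m Cmat x ⬝ᵥ (U t ω + V t x ω) -
        V t x ω ⬝ᵥ balancedEncoding m (Z (t + 1) ω)) :
    ∫ ω, (f (X T ω) -
        ((∑ x, μ x * Y 0 x ω) -
          ∑ t ∈ range T, U t ω ⬝ᵥ balancedEncoding m (Z (t + 1) ω))) ^ 2 ∂P =
      (∫ ω, ((∑ x, μ x * Y 0 x ω ^ 2) - (∑ x, μ x * Y 0 x ω) ^ 2) ∂P) +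
        ∫ ω, ∑ t ∈ range T,
          (carre d A (fun y => Y (t + 1) y ω) (X t ω) +
            (U t ω + V t (X t ω) ω) ⬝ᵥ
              (Rmat d m Cmat (X t ω)).mulVec (U t ω + V t (X t ω) ω)) ∂P := by
  have hA' : ∀ x, ∑ y, A x y = 1 := fun x => (hA x).2
  have hC' : ∀ x, ∑ z, Cmat x z = 1 := fun x => (hC x).2
  have hpathT : ∀ xs zs, P.real (pathEvent X Z T xs zs) = pathWeight A Cmat μ T xs zs := by
    intro xs zs
    have h := hlaw (fun s => xs s) (fun s => zs s)
    have hset : {ω | (∀ t : Fin (T + 1), X (t : ℕ) ω = xs t) ∧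
        (∀ t : Fin T, Z ((t : ℕ) + 1) ω = zs t)} = pathEvent X Z T xs zs := by
      ext ω
      simp [pathEvent, Fin.forall_iff]
    have hprod : μ (xs ((0 : Fin (T + 1)) : ℕ)) * ∏ t : Fin T,
        (A (xs (t.castSucc : ℕ)) (xs (t.succ : ℕ)) * Cmat (xs (t.castSucc : ℕ)) (zs t)) =
        pathWeight A Cmat μ T xs zs := by
      simp only [Fin.val_castSucc, Fin.val_succ, Fin.val_zero, pathWeight]
      rw [Fin.prod_univ_eq_prod_range (fun s => A (xs s) (xs (s + 1)) * Cmat (xs s) (zs s))]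
    rw [hset, hprod] at h
    rw [measureReal_def, h, ENNReal.toReal_ofReal]
    exact mul_nonneg (hμ.1 _) (prod_nonneg fun s _ => mul_nonneg ((hA _).1 _) ((hC _).1 _))
  have hpath : ∀ t ≤ T, ∀ xs zs, P.real (pathEvent X Z t xs zs) = pathWeight A Cmat μ t xs zs :=
    fun t ht => measureReal_pathEvent hXm hZm hA' hC' hpathT ht
  have hH := measurable_history hXm hZm
  have hUdep : ∀ {t ω ω'}, t < T → (∀ s < t, Z (s + 1) ω = Z (s + 1) ω') → U t ω = U t ω' :=
    fun ht h => eq_of_measurable_obsFiltration (hUad _ ht) h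
  have hYdep : ∀ {t x ω ω'}, t ≤ T → (∀ s < t, Z (s + 1) ω = Z (s + 1) ω') →
      Y t x ω = Y t x ω' := fun ht h => eq_of_measurable_obsFiltration (hYad _ ht _) h
  have hVdep : ∀ {t x ω ω'}, t < T → (∀ s < t, Z (s + 1) ω = Z (s + 1) ω') →
      V t x ω = V t x ω' := fun ht h => eq_of_measurable_obsFiltration (hVad _ ht _) h
  have hY0 : ∀ x ω ω', Y 0 x ω = Y 0 x ω' :=
    fun x ω ω' => hYdep (Nat.zero_le T) fun s hs => absurd hs (Nat.not_lt_zero s)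
  set W : ℕ → Ω → ℝ := fun n ω => Y n (X n ω) ω - ((∑ x, μ x * Y 0 x ω) -
    ∑ t ∈ range n, U t ω ⬝ᵥ balancedEncoding m (Z (t + 1) ω)) with hW
  set Q : ℕ → Ω → ℝ := fun t ω => carre d A (fun y => Y (t + 1) y ω) (X t ω) +
    (U t ω + V t (X t ω) ω) ⬝ᵥ
      (Rmat d m Cmat (X t ω)).mulVec (U t ω + V t (X t ω) ω) with hQ
  have hstep : ∀ t < T, Integrable (Q t) P ∧
      ∫ ω, W (t + 1) ω ^ 2 ∂P = ∫ ω, W t ω ^ 2 ∂P + ∫ ω, Q t ω ∂P := by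
    intro t ht
    obtain ⟨w, hw⟩ : ∃ w, W t = w ∘ history X Z t := by
      rw [← Function.factorsThrough_iff]
      intro ω ω' h
      obtain ⟨hX, hZ⟩ := history_eq_iff.1 h
      have hsum : ∑ s ∈ range t, U s ω ⬝ᵥ balancedEncoding m (Z (s + 1) ω) =
          ∑ s ∈ range t, U s ω' ⬝ᵥ balancedEncoding m (Z (s + 1) ω') := by
        refine sum_congr rfl fun s hs => ?_
        have hs' := mem_range.1 hs
        rw [hZ s hs', hUdep (hs'.trans ht) fun r hr => hZ r (hr.trans hs')]
      simp only [hW, hX t le_rfl, hYdep ht.le hZ, hsum, hY0 _ ω ω']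
    obtain ⟨a, ha⟩ : ∃ a, (fun ω => U t ω + V t (X t ω) ω) = a ∘ history X Z t := by
      rw [← Function.factorsThrough_iff]
      intro ω ω' h
      obtain ⟨hX, hZ⟩ := history_eq_iff.1 h
      simp only [hX t le_rfl, hUdep ht hZ, hVdep ht hZ]
    obtain ⟨g, hg⟩ : ∃ g, (fun ω y => Y (t + 1) y ω) =
        g ∘ fun ω => (history X Z t ω, Z (t + 1) ω) := by
      rw [← Function.factorsThrough_iff]
      intro ω ω' h
      obtain ⟨h1, h2⟩ := Prod.ext_iff.1 h
      obtain ⟨-, hZ⟩ := history_eq_iff.1 h1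
      ext y
      refine hYdep ht fun s hs => ?_
      rcases Nat.lt_succ_iff_lt_or_eq.1 hs with hs | rfl
      exacts [hZ s hs, h2]
    have hw' : ∀ ω, W t ω = w (history X Z t ω) := congrFun hw
    have ha' : ∀ ω, U t ω + V t (X t ω) ω = a (history X Z t ω) := congrFun ha
    have hg' : ∀ ω y, Y (t + 1) y ω = g (history X Z t ω, Z (t + 1) ω) y :=
      fun ω y => congrFun (congrFun hg ω) y
    have hlast : ∀ ω, (history X Z t ω).1 (Fin.last t) = X t ω := fun ω => by simp [history]
    have hQ' : ∀ ω, Q t ω = carre d A (g (history X Z t ω, Z (t + 1) ω)) (X t ω) +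
        a (history X Z t ω) ⬝ᵥ (Rmat d m Cmat (X t ω)).mulVec (a (history X Z t ω)) := by
      intro ω
      simp only [hQ, ha', hg']
    have hQint : Integrable (Q t) P := by
      have := integrable_comp_of_finite (P := P) ((hH t).prodMk (hZm (t + 1))) (fun b =>
        carre d A (g b) (b.1.1 (Fin.last t)) +
          a b.1 ⬝ᵥ (Rmat d m Cmat (b.1.1 (Fin.last t))).mulVec (a b.1))
      simp only [hlast] at this
      exact this.congr (.of_forall fun ω => (hQ' ω).symm)
    have hWint : Integrable (fun ω => W t ω ^ 2) P := by
      simp only [hw']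
      exact integrable_comp_of_finite (hH t) fun h => w h ^ 2
    refine ⟨hQint, ?_⟩
    have hWsucc : ∀ᵐ ω ∂P, W (t + 1) ω =
        w (history X Z t ω) + (g (history X Z t ω, Z (t + 1) ω) (X (t + 1) ω) -
          ∑ y, A (X t ω) y * g (history X Z t ω, Z (t + 1) ω) y) +
        (a (history X Z t ω) ⬝ᵥ balancedEncoding m (Z (t + 1) ω) -
          a (history X Z t ω) ⬝ᵥ cvec d m Cmat (X t ω)) := by
      filter_upwards [ae_all_iff.2 (hBSDE t ht)] with ω hω
      have h := hω (X t ω)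
      simp only [← hw', ← ha', ← hg', hW, sum_range_succ, h, add_dotProduct,
        dotProduct_comm (cvec d m Cmat (X t ω))]
      ring
    have hsum : ∀ ω, _ := fun ω => sum_transition_emission_sq (X t ω) (hA' _) (hC' _)
      (w (history X Z t ω)) (a (history X Z t ω)) fun z => g (history X Z t ω, z)
    have hK := integral_history_step hXm hZm (hpath t ht.le) (hpath (t + 1) ht) fun h y z =>
      (w h + (g (h, z) y - ∑ y', A (h.1 (Fin.last t)) y' * g (h, z) y') +
        (a h ⬝ᵥ balancedEncoding m z - a h ⬝ᵥ cvec d m Cmat (h.1 (Fin.last t)))) ^ 2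
    have hK' := integral_history_step hXm hZm (hpath t ht.le) (hpath (t + 1) ht) fun h _ z =>
      w h ^ 2 + (carre d A (g (h, z)) (h.1 (Fin.last t)) +
        a h ⬝ᵥ (Rmat d m Cmat (h.1 (Fin.last t))).mulVec (a h))
    simp only [hlast] at hK hK'
    simp only [hsum] at hK
    rw [integral_congr_ae (hWsucc.mono fun ω h => congrArg (· ^ 2) h), hK, ← hK',
      ← integral_add hWint hQint]
    simp only [hw', hQ']
  have htel : ∀ n ≤ T, ∫ ω, W n ω ^ 2 ∂P =
      ∫ ω, W 0 ω ^ 2 ∂P + ∑ t ∈ range n, ∫ ω, Q t ω ∂P := by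
    intro n
    induction n with
    | zero => simp
    | succ n ih =>
      intro hn
      rw [(hstep n hn).2, ih (by omega), sum_range_succ, add_assoc]
  have hinit : ∫ ω, W 0 ω ^ 2 ∂P =
      ∫ ω, ((∑ x, μ x * Y 0 x ω ^ 2) - (∑ x, μ x * Y 0 x ω) ^ 2) ∂P := by
    obtain ⟨ω₀⟩ : Nonempty Ω := P.nonempty_of_neZero
    simp only [hW, range_zero, sum_empty, sub_zero, hY0 _ _ ω₀]
    rw [integral_comp_of_fintype (hXm 0) fun x => (Y 0 x ω₀ - ∑ x, μ x * Y 0 x ω₀) ^ 2,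
      integral_const, probReal_univ, one_smul]
    have hX0 : ∀ x, P.real {ω | X 0 ω = x} = μ x := by
      intro x
      simpa [pathEvent, pathWeight] using hpath 0 (Nat.zero_le T) (fun _ => x) (fun _ => 0)
    set b := ∑ x, μ x * Y 0 x ω₀ with hb
    have e : ∀ x, P.real {ω | X 0 ω = x} * (Y 0 x ω₀ - b) ^ 2 =
        μ x * Y 0 x ω₀ ^ 2 - 2 * b * (μ x * Y 0 x ω₀) + b ^ 2 * μ x := fun x => by
      rw [hX0]
      ring
    simp only [e, sum_add_distrib, sum_sub_distrib, ← mul_sum, ← hb, hμ.2]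
    ring
  rw [integral_finsetSum _ fun t ht => (hstep t (mem_range.1 ht)).1, ← hinit, ← htel T le_rfl]
  simp only [hW, hYT]

end
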